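/- Let $(X,\mu,T)$ be ergodic and let $f_n: X \to [-\infty,+\infty)$ be measurable functions with $f_1^+ \in L^1(\mu)$ satisfying $f_{n+m} \leq f_n + f_m \circ T^n$ for all $n,m \geq 1$. Then the sequence $\{\int f_n \, d\mu\}$ is sub-additive, and for $\mu$-a.e. $x$, $\frac{1}{n}f_n(x)$ converges to $\inf_{n\geq 1}\frac{1}{n}\int f_n\,d\mu \in [-\infty,+\infty)$. -/

import Mathlib

open MeasureTheory Filter Topology

noncomputable section

/-- Positive part of an extended real, as an `ℝ≥0∞`. -/
def erealPos (a : EReal) : ENNReal := if a = ⊤ then ⊤ else ENNReal.ofReal a.toReal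

/-- The integral of an `EReal`-valued function taking values in `[-∞,+∞)`:
it equals `-∞` when the negative part has infinite integral, and otherwise the
difference of the integrals of the positive and negative parts. -/
def eint {X : Type*} [MeasurableSpace X] (μ : Measure X) (g : X → EReal) : EReal :=
  if ∫⁻ x, erealPos (-(g x)) ∂μ = ⊤ then ⊥
  else (((∫⁻ x, erealPos (g x) ∂μ).toReal - (∫⁻ x, erealPos (-(g x)) ∂μ).toReal : ℝ) : EReal)

/-- The integral of a Birkhoff sum along a measure-preserving map is the number of summands times
the integral of the summand. -/
theorem integral_birkhoffSum {X : Type*} [MeasurableSpace X] {μ : Measure X} {T : X → X}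
    (hT : MeasurePreserving T μ μ) {g : X → ℝ} (hg : Integrable g μ) (n : ℕ) :
    Integrable (birkhoffSum T g n) μ ∧ ∫ x, birkhoffSum T g n x ∂μ = n * ∫ x, g x ∂μ := by
  have hi : ∀ k, Integrable (fun x => g (T^[k] x)) μ := fun k =>
    (hT.iterate k).integrable_comp_of_integrable hg
  have he : ∀ k, ∫ x, g (T^[k] x) ∂μ = ∫ x, g x ∂μ := by
    intro k
    have h := (hT.iterate k).map_eq
    rw [← integral_map (hT.iterate k).measurable.aemeasurable
      (h.symm ▸ hg.aestronglyMeasurable), h]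
  refine ⟨integrable_finsetSum _ fun k _ => hi k, ?_⟩
  simp only [birkhoffSum]
  rw [integral_finsetSum _ fun k _ => hi k]
  simp [he]

/-- Birkhoff sums of a nonnegative function are nonnegative. -/
theorem birkhoffSum_nonneg {X : Type*} {T : X → X} {g : X → ℝ} (hg : ∀ x, 0 ≤ g x) (n : ℕ)
    (x : X) : 0 ≤ birkhoffSum T g n x :=
  Finset.sum_nonneg fun _ _ => hg _

/-- Birkhoff sums are monotone in the function. -/
theorem birkhoffSum_le_birkhoffSum {X : Type*} {T : X → X} {g g' : X → ℝ} (h : ∀ x, g x ≤ g' x)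
    (n : ℕ) (x : X) : birkhoffSum T g n x ≤ birkhoffSum T g' n x :=
  Finset.sum_le_sum fun _ _ => h _

/-- Birkhoff sums of a nonnegative function are monotone in the number of summands. -/
theorem birkhoffSum_mono {X : Type*} {T : X → X} {g : X → ℝ} (hg : ∀ x, 0 ≤ g x) {m n : ℕ}
    (hmn : m ≤ n) (x : X) : birkhoffSum T g m x ≤ birkhoffSum T g n x := by
  obtain ⟨k, rfl⟩ := Nat.exists_eq_add_of_le hmn
  rw [birkhoffSum_add]
  linarith [birkhoffSum_nonneg (T := T) hg k (T^[m] x)]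

/-- Along almost every orbit, an integrable function grows sublinearly. -/
theorem ae_forall_eventually_abs_iterate_le {X : Type*} [MeasurableSpace X] {μ : Measure X}
    [IsProbabilityMeasure μ] {T : X → X} (hT : MeasurePreserving T μ μ) {g : X → ℝ}
    (hg : Integrable g μ) {ε : ℝ} (hε : 0 < ε) :
    ∀ᵐ x ∂μ, ∀ᶠ n : ℕ in atTop, |g (T^[n] x)| ≤ n * ε := by
  let : MeasureSpace X := ⟨μ⟩
  have : IsProbabilityMeasure (volume : Measure X) := ‹IsProbabilityMeasure μ›
  have hsum := ProbabilityTheory.tsum_prob_mem_Ioi_lt_top (Ω := X) (X := fun x => |g x| / ε)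
    (hg.abs.div_const ε) (fun x => by positivity)
  have hnm : ∀ n : ℕ, NullMeasurableSet {x | |g x| / ε ∈ Set.Ioi (n : ℝ)} μ := fun n =>
    (hg.abs.div_const ε).aestronglyMeasurable.aemeasurable.nullMeasurableSet_preimage
      measurableSet_Ioi
  have hsum' : (∑' n : ℕ, μ (T^[n] ⁻¹' {x | |g x| / ε ∈ Set.Ioi (n : ℝ)})) ≠ ⊤ := by
    simp_rw [fun n : ℕ => (hT.iterate n).measure_preimage (hnm n)]
    exact hsum.ne
  filter_upwards [ae_eventually_notMem hsum'] with x hx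
  filter_upwards [hx] with n hn
  simpa [div_le_iff₀ hε] using hn

/-- A subadditive process over `T` with values in `ℝ`. -/
structure SubadditiveProcess {X : Type*} (T : X → X) (f : ℕ → X → ℝ) : Prop where
  zero : ∀ x, f 0 x = 0
  add_le : ∀ n m x, f (n + m) x ≤ f n x + f m (T^[n] x)

namespace SubadditiveProcess

variable {X : Type*} {T : X → X} {f : ℕ → X → ℝ}

theorem neg_birkhoffSum (T : X → X) (g : X → ℝ) :
    SubadditiveProcess T fun n x => -birkhoffSum T g n x where
  zero x := by simp
  add_le n m x := by rw [birkhoffSum_add]; linarith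

theorem le_birkhoffSum (hf : SubadditiveProcess T f) (n : ℕ) (x : X) :
    f n x ≤ birkhoffSum T (f 1) n x := by
  induction n with
  | zero => simp [hf.zero]
  | succ n ih =>
    rw [birkhoffSum_succ]
    linarith [hf.add_le n 1 x]

theorem mul_le_birkhoffSum (hf : SubadditiveProcess T f) (m q : ℕ) (x : X) :
    f (m * q) x ≤ birkhoffSum T^[m] (f m) q x := by
  induction q with
  | zero => simp [hf.zero]
  | succ q ih =>
    rw [birkhoffSum_succ, ← Function.iterate_mul, mul_add, mul_one]
    linarith [hf.add_le (m * q) m x]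

/-- If every point starts a block of length at most `N` along which `f` is bounded by the Birkhoff
sum of `ψ`, then `f` is bounded by the Birkhoff sums of `ψ` up to an error coming from the last `N`
iterates. -/
theorem le_of_block_bound (hf : SubadditiveProcess T f) {ψ h : X → ℝ} (hh : ∀ x, 0 ≤ h x)
    (h1 : ∀ x, f 1 x ≤ ψ x + h x) {N : ℕ}
    (hN : ∀ x, ∃ n, 1 ≤ n ∧ n ≤ N ∧ f n x ≤ birkhoffSum T ψ n x) (K : ℕ) (x : X) :
    f K x ≤ birkhoffSum T ψ K x + (birkhoffSum T h K x - birkhoffSum T h (K - N) x) := by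
  induction K using Nat.strong_induction_on generalizing x with
  | _ K ih =>
    obtain ⟨n, hn1, hnN, hn⟩ := hN x
    rcases lt_or_ge K n with hlt | hle
    · have h0 : K - N = 0 := by omega
      rw [h0, birkhoffSum_zero, sub_zero, ← birkhoffSum_add']
      exact (hf.le_birkhoffSum K x).trans (birkhoffSum_le_birkhoffSum h1 K x)
    rcases Nat.eq_zero_or_pos K with rfl | hK
    · simp [hf.zero]
    obtain ⟨k, rfl⟩ := Nat.exists_eq_add_of_le hle
    have := ih k (by omega) (T^[n] x)
    have hadd := hf.add_le n k x
    have hm := birkhoffSum_mono (T := T) hh (show n + k - N ≤ n + (k - N) by omega) x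
    rw [birkhoffSum_add] at hm
    rw [birkhoffSum_add T ψ, birkhoffSum_add T h n k]
    linarith

theorem frequently_lt_of_frequently_lt_map (hf : SubadditiveProcess T f) {a b : ℝ} (hab : a < b)
    {x : X} (h : ∃ᶠ n : ℕ in atTop, f n (T x) < n * a) : ∃ᶠ n : ℕ in atTop, f n x < n * b := by
  have hev : ∀ᶠ n : ℕ in atTop, (f 1 x - b) / (b - a) ≤ n :=
    tendsto_natCast_atTop_atTop.eventually_ge_atTop _
  refine (tendsto_add_atTop_nat 1).frequently ((h.and_eventually hev).mono ?_)
  rintro n ⟨h1, h2⟩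
  rw [div_le_iff₀ (by linarith)] at h2
  have := hf.add_le 1 n x
  rw [Function.iterate_one, add_comm 1 n] at this
  push_cast
  linarith

theorem frequently_gt_map_of_frequently_gt (hf : SubadditiveProcess T f) {a b : ℝ} (hab : a < b)
    {x : X} (h : ∃ᶠ n : ℕ in atTop, n * b < f n x) : ∃ᶠ n : ℕ in atTop, n * a < f n (T x) := by
  have hev : ∀ᶠ n : ℕ in atTop, 1 ≤ n ∧ (f 1 x - a) / (b - a) ≤ n :=
    (eventually_ge_atTop 1).and (tendsto_natCast_atTop_atTop.eventually_ge_atTop _)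
  refine (tendsto_sub_atTop_nat 1).frequently ((h.and_eventually hev).mono ?_)
  rintro n ⟨h1, h2, h3⟩
  rw [div_le_iff₀ (by linarith)] at h3
  obtain ⟨k, rfl⟩ := Nat.exists_eq_add_of_le h2
  have := hf.add_le 1 k x
  rw [Function.iterate_one] at this
  push_cast at h1 h3
  rw [Nat.add_sub_cancel_left]
  linarith

theorem exists_le_birkhoffSum_of_frequently (hf : SubadditiveProcess T f) {m : ℕ} (hm : 1 ≤ m)
    {a c : ℝ} (hca : c < a) {x : X}
    (hx : ∀ j : ℕ, ∀ᶠ n : ℕ in atTop, |f 1 (T^[n] x)| ≤ n * (1 / ((j : ℝ) + 1)))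
    (h : ∃ᶠ n : ℕ in atTop, n * a < f n x) :
    ∃ q : ℕ, 1 ≤ q ∧ q * (m * c) ≤ birkhoffSum T^[m] (f m) q x := by
  have hm0 : (0 : ℝ) < m := by exact_mod_cast hm
  obtain ⟨j, hj⟩ := exists_nat_one_div_lt (show 0 < (a - c) / 2 / m by
    have := sub_pos.2 hca; positivity)
  set ε : ℝ := 1 / ((j : ℝ) + 1) with hε
  have hε0 : 0 < ε := by positivity
  rw [lt_div_iff₀ hm0] at hj
  obtain ⟨N, hN⟩ := eventually_atTop.1 (hx j)
  have hev : ∀ᶠ n : ℕ in atTop, N + m ≤ n ∧ m * |c| / ((a - c) / 2) ≤ n :=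
    (eventually_ge_atTop _).and (tendsto_natCast_atTop_atTop.eventually_ge_atTop _)
  obtain ⟨n, hn, hnN, hnc⟩ := (h.and_eventually hev).exists
  rw [div_le_iff₀ (by linarith)] at hnc
  have hqr := Nat.div_add_mod n m
  have hr := Nat.mod_lt n (show m > 0 by omega)
  have hq1 : 1 ≤ n / m := (Nat.one_le_div_iff (by omega)).2 (by omega)
  generalize n / m = q at *
  generalize n % m = r at *
  refine ⟨q, hq1, ?_⟩
  have hrR : (r : ℝ) ≤ m := by exact_mod_cast hr.le
  have hqrR : (m : ℝ) * q + r = n := by exact_mod_cast hqr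
  have h1 : f n x ≤ f (m * q) x + f r (T^[m * q] x) := hqr ▸ hf.add_le (m * q) r x
  have h2 := hf.mul_le_birkhoffSum m q x
  have h3 := hf.le_birkhoffSum r (T^[m * q] x)
  have h4 : birkhoffSum T (f 1) r (T^[m * q] x) ≤ r * (n * ε) := by
    have : ∀ i ∈ Finset.range r, f 1 (T^[i] (T^[m * q] x)) ≤ n * ε := by
      intro i hi
      rw [Finset.mem_range] at hi
      rw [← Function.iterate_add_apply]
      refine (le_abs_self _).trans ((hN _ (by omega)).trans ?_)
      gcongr
      omega
    simpa [birkhoffSum] using Finset.sum_le_sum this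
  have h5 : r * (n * ε) ≤ n * ((a - c) / 2) := by
    calc r * (n * ε) ≤ m * (n * ε) := by gcongr
      _ = n * (ε * m) := by ring
      _ ≤ _ := by gcongr
  have h6 : (q : ℝ) * (m * c) = n * c - r * c := by rw [← hqrR]; ring
  have h7 : -(r * c) ≤ m * |c| := by
    calc -(r * c) = r * (-c) := by ring
      _ ≤ r * |c| := by gcongr; exact neg_le_abs c
      _ ≤ _ := by gcongr
  linarith

variable [MeasurableSpace X] {μ : Measure X} [IsProbabilityMeasure μ]

/-- If almost every orbit has some average `f n x / n` at most `M`, then every lower bound of the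
averages of the integrals is at most `M`. -/
theorem le_of_forall_exists_le (hT : MeasurePreserving T μ μ) (hf : SubadditiveProcess T f)
    (hmeas : ∀ n, Measurable (f n)) (hint : ∀ n, Integrable (f n) μ) {L M : ℝ}
    (hL : ∀ n : ℕ, n * L ≤ ∫ x, f n x ∂μ)
    (hM : ∀ᵐ x ∂μ, ∃ n : ℕ, 1 ≤ n ∧ f n x ≤ n * M) : L ≤ M := by
  set B : ℕ → Set X := fun N => {x | ∀ n : ℕ, 1 ≤ n → n ≤ N + 1 → n * M < f n x} with hB
  have hBm : ∀ N, MeasurableSet (B N) := by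
    intro N
    simp only [hB, Set.ofPred_forall]
    refine MeasurableSet.iInter fun n => MeasurableSet.iInter fun _ => MeasurableSet.iInter fun _ =>
      measurableSet_lt measurable_const (hmeas n)
  have hBanti : Antitone B := fun a b hab x hx n h1 h2 => hx n h1 (by omega)
  set h : X → ℝ := fun x => |f 1 x| + |M| with hh
  have hhint : Integrable h μ := (hint 1).abs.add (integrable_const _)
  have hh0 : ∀ x, 0 ≤ h x := fun x => by positivity
  have hlim := tendsto_setIntegral_of_antitone hBm hBanti ⟨0, hhint.integrableOn⟩
  have hnull : μ (⋂ n, B n) = 0 := by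
    rw [measure_eq_zero_iff_ae_notMem]
    filter_upwards [hM] with x ⟨n, hn1, hn⟩ hx
    exact absurd (Set.mem_iInter.1 hx n n hn1 (by omega)) (not_lt.2 hn)
  rw [setIntegral_measure_zero _ hnull] at hlim
  have key : ∀ N, L ≤ M + ∫ x in B N, h x ∂μ := by
    intro N
    set ψ : X → ℝ := fun x => M + (B N).indicator h x with hψ
    have hindint : Integrable ((B N).indicator h) μ := hhint.indicator (hBm N)
    have hψint : Integrable ψ μ := (integrable_const _).add hindint
    have hind0 : ∀ x, 0 ≤ (B N).indicator h x := fun x => Set.indicator_nonneg (fun x _ => hh0 x) x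
    have hψI : ∫ x, ψ x ∂μ = M + ∫ x in B N, h x ∂μ := by
      rw [hψ, integral_add (integrable_const _) hindint, integral_indicator (hBm N)]
      simp
    have hblock : ∀ x, ∃ n, 1 ≤ n ∧ n ≤ N + 1 ∧ f n x ≤ birkhoffSum T ψ n x := by
      intro x
      by_cases hx : x ∈ B N
      · refine ⟨1, le_rfl, by omega, ?_⟩
        rw [birkhoffSum_one]
        simp only [hψ, Set.indicator_of_mem hx, hh]
        linarith [le_abs_self (f 1 x), neg_abs_le M]
      · simp only [hB, Set.mem_ofPred_eq, not_forall, not_lt] at hx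
        obtain ⟨n, h1, h2, h3⟩ := hx
        refine ⟨n, h1, h2, h3.trans ?_⟩
        calc (n : ℝ) * M = birkhoffSum T (fun _ => M) n x := by simp [birkhoffSum]
          _ ≤ _ := birkhoffSum_le_birkhoffSum (fun y => by simpa [hψ] using hind0 y) n x
    have h1 : ∀ x, f 1 x ≤ ψ x + h x := fun x => by
      simp only [hψ, hh]
      linarith [le_abs_self (f 1 x), neg_abs_le M, hind0 x]
    rw [← hψI]
    have hK : ∀ K : ℕ, (K : ℝ) * (L - ∫ x, ψ x ∂μ) ≤ (N + 1 : ℕ) * ∫ x, h x ∂μ := by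
      intro K
      have hKψ := integral_birkhoffSum hT hψint K
      have hKh := integral_birkhoffSum hT hhint K
      have hKh' := integral_birkhoffSum hT hhint (K - (N + 1))
      have hsubint : Integrable
          (fun x => birkhoffSum T h K x - birkhoffSum T h (K - (N + 1)) x) μ := hKh.1.sub hKh'.1
      have hle : ∫ x, f K x ∂μ ≤ ∫ x, (birkhoffSum T ψ K x +
          (birkhoffSum T h K x - birkhoffSum T h (K - (N + 1)) x)) ∂μ :=
        integral_mono (hint K) (hKψ.1.add hsubint)
          (hf.le_of_block_bound hh0 h1 hblock K)
      rw [integral_add hKψ.1 hsubint, integral_sub hKh.1 hKh'.1, hKψ.2, hKh.2,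
        hKh'.2] at hle
      have hI : 0 ≤ ∫ x, h x ∂μ := integral_nonneg hh0
      have hc : (K : ℝ) ≤ ((K - (N + 1) : ℕ) : ℝ) + (N + 1 : ℕ) := by
        exact_mod_cast (by omega)
      nlinarith [hL K, mul_le_mul_of_nonneg_right hc hI]
    by_contra! hlt
    obtain ⟨K, hKlt⟩ := exists_nat_gt (((N + 1 : ℕ) * ∫ x, h x ∂μ) / (L - ∫ x, ψ x ∂μ))
    rw [div_lt_iff₀ (by linarith)] at hKlt
    exact absurd (hK K) (not_le.2 hKlt)
  simpa using ge_of_tendsto' (hlim.const_add M) key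

theorem ae_eventually_mul_le (hT : Ergodic T μ) (hf : SubadditiveProcess T f)
    (hmeas : ∀ n, Measurable (f n)) (hint : ∀ n, Integrable (f n) μ) {L : ℝ}
    (hL : ∀ n : ℕ, n * L ≤ ∫ x, f n x ∂μ) {a : ℝ} (ha : a < L) :
    ∀ᵐ x ∂μ, ∀ᶠ n : ℕ in atTop, n * a ≤ f n x := by
  obtain ⟨c, hac, hcL⟩ := exists_between ha
  set E : Set X := {x | ∃ q : ℚ, (q : ℝ) < c ∧ ∃ᶠ n : ℕ in atTop, f n x < n * q} with hE
  have hEm : MeasurableSet E := by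
    simp only [hE, frequently_atTop]
    refine measurableSet_setOfPred.2 (Measurable.exists fun q => Measurable.and measurable_const
      (Measurable.forall fun i => Measurable.exists fun n => Measurable.and measurable_const ?_))
    exact measurableSet_setOfPred.1 (measurableSet_lt (hmeas n) measurable_const)
  have hsub : T ⁻¹' E ⊆ E := by
    rintro x ⟨q, hqc, hq⟩
    obtain ⟨r, hqr, hrc⟩ := exists_rat_btwn hqc
    exact ⟨r, hrc, hf.frequently_lt_of_frequently_lt_map hqr hq⟩
  rcases hT.ae_empty_or_univ_of_preimage_ae_le hEm.nullMeasurableSet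
    (Eventually.of_forall hsub) with h | h
  · obtain ⟨q, haq, hqc⟩ := exists_rat_btwn hac
    filter_upwards [ae_eq_empty.1 h |> measure_eq_zero_iff_ae_notMem.1] with x hx
    have : ∀ᶠ n : ℕ in atTop, n * (q : ℝ) ≤ f n x := by
      by_contra hcon
      exact hx ⟨q, hqc, (not_eventually.1 hcon).mono fun n => not_le.1⟩
    filter_upwards [this] with n hn
    exact (mul_le_mul_of_nonneg_left haq.le n.cast_nonneg).trans hn
  · refine absurd (hf.le_of_forall_exists_le hT.toMeasurePreserving hmeas hint hL (M := c) ?_)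
      (not_le.2 hcL)
    filter_upwards [eventuallyEq_univ.1 h] with x ⟨q, hqc, hq⟩
    obtain ⟨n, hn, hn1⟩ := (hq.and_eventually (eventually_ge_atTop 1)).exists
    exact ⟨n, hn1, hn.le.trans (mul_le_mul_of_nonneg_left hqc.le n.cast_nonneg)⟩

theorem ae_eventually_le_mul (hT : Ergodic T μ) (hf : SubadditiveProcess T f)
    (hmeas : ∀ n, Measurable (f n)) (hint : ∀ n, Integrable (f n) μ) {m : ℕ} (hm : 1 ≤ m) {b : ℝ}
    (hb : ∫ x, f m x ∂μ < m * b) :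
    ∀ᵐ x ∂μ, ∀ᶠ n : ℕ in atTop, f n x ≤ n * b := by
  have hm0 : (0 : ℝ) < m := by exact_mod_cast hm
  obtain ⟨c, hLc, hcb⟩ := exists_between ((div_lt_iff₀' hm0).2 hb)
  rw [div_lt_iff₀' hm0] at hLc
  set E : Set X := {x | ∃ q : ℚ, c < q ∧ ∃ᶠ n : ℕ in atTop, n * (q : ℝ) < f n x} with hE
  have hEm : MeasurableSet E := by
    simp only [hE, frequently_atTop]
    refine measurableSet_setOfPred.2 (Measurable.exists fun q => Measurable.and measurable_const
      (Measurable.forall fun i => Measurable.exists fun n => Measurable.and measurable_const ?_))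
    exact measurableSet_setOfPred.1 (measurableSet_lt measurable_const (hmeas n))
  have hsub : E ⊆ T ⁻¹' E := by
    rintro x ⟨q, hcq, hq⟩
    obtain ⟨r, hcr, hrq⟩ := exists_rat_btwn hcq
    exact ⟨r, hcr, hf.frequently_gt_map_of_frequently_gt hrq hq⟩
  rcases hT.ae_empty_or_univ_of_ae_le_preimage hEm.nullMeasurableSet
    (Eventually.of_forall hsub) with h | h
  · obtain ⟨q, hcq, hqb⟩ := exists_rat_btwn hcb
    filter_upwards [ae_eq_empty.1 h |> measure_eq_zero_iff_ae_notMem.1] with x hx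
    have : ∀ᶠ n : ℕ in atTop, f n x ≤ n * (q : ℝ) := by
      by_contra hcon
      exact hx ⟨q, hcq, (not_eventually.1 hcon).mono fun n => not_le.1⟩
    filter_upwards [this] with n hn
    exact hn.trans (mul_le_mul_of_nonneg_left hqb.le n.cast_nonneg)
  · have hTm := hT.toMeasurePreserving.iterate m
    have hS := integral_birkhoffSum hTm (hint m)
    have hSm : ∀ n, Measurable (birkhoffSum T^[m] (f m) n) := fun n =>
      Finset.measurable_fun_sum _ fun k _ => (hmeas m).comp (hTm.iterate k).measurable
    have hsmall := ae_all_iff.2 fun j : ℕ => ae_forall_eventually_abs_iterate_le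
      hT.toMeasurePreserving (hint 1) (Nat.one_div_pos_of_nat (α := ℝ) (n := j))
    have hle := (neg_birkhoffSum T^[m] (f m)).le_of_forall_exists_le hTm
      (fun n => (hSm n).neg) (fun n => (hS n).1.neg) (L := -∫ x, f m x ∂μ) (M := -(m * c))
      (fun n => by rw [integral_neg, (hS n).2, mul_neg]) (by
        filter_upwards [eventuallyEq_univ.1 h, hsmall] with x ⟨q, hcq, hq⟩ hxs
        obtain ⟨k, hk1, hk⟩ := hf.exists_le_birkhoffSum_of_frequently hm hcq hxs hq
        exact ⟨k, hk1, by linarith⟩)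
    linarith

end SubadditiveProcess

/-- An extended real, truncated from below at `-c`. -/
def truncBelow (c : ℝ) (a : EReal) : ℝ := (max a ((-c : ℝ) : EReal)).toReal

theorem coe_truncBelow (c : ℝ) {a : EReal} (ha : a ≠ ⊤) :
    (truncBelow c a : EReal) = max a ((-c : ℝ) : EReal) := by
  refine EReal.coe_toReal ?_ ?_
  · exact (max_lt (lt_top_iff_ne_top.2 ha) (EReal.coe_lt_top _)).ne
  · exact ((EReal.bot_lt_coe _).trans_le (le_max_right _ _)).ne'

theorem truncBelow_add_le (c c' : ℝ) {a b d : EReal} (ha : a ≠ ⊤) (hb : b ≠ ⊤) (hd : d ≠ ⊤)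
    (h : a ≤ b + d) : truncBelow (c + c') a ≤ truncBelow c b + truncBelow c' d := by
  rw [← EReal.coe_le_coe_iff, EReal.coe_add, coe_truncBelow _ ha, coe_truncBelow _ hb,
    coe_truncBelow _ hd]
  refine max_le (h.trans (add_le_add (le_max_left _ _) (le_max_left _ _))) ?_
  rw [neg_add, EReal.coe_add]
  exact add_le_add (le_max_right _ _) (le_max_right _ _)

theorem truncBelow_anti {a : EReal} (ha : a ≠ ⊤) : Antitone fun c => truncBelow c a := by
  intro c c' h
  rw [← EReal.coe_le_coe_iff, coe_truncBelow _ ha, coe_truncBelow _ ha]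
  exact max_le_max le_rfl (EReal.coe_le_coe_iff.2 (neg_le_neg h))

theorem measurable_truncBelow (c : ℝ) : Measurable (truncBelow c) :=
  (measurable_id.max measurable_const).ereal_toReal

theorem abs_truncBelow_le {c : ℝ} (hc : 0 ≤ c) {a : EReal} (ha : a ≠ ⊤) :
    |truncBelow c a| ≤ max a.toReal 0 + c := by
  have h0 : 0 ≤ max a.toReal 0 := le_max_right _ _
  rw [abs_le]
  constructor
  · rw [← EReal.coe_le_coe_iff, coe_truncBelow _ ha]
    exact (EReal.coe_le_coe_iff.2 (by linarith)).trans (le_max_right _ _)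
  · rw [← EReal.coe_le_coe_iff, coe_truncBelow _ ha]
    refine max_le ((EReal.le_coe_toReal ha).trans (EReal.coe_le_coe_iff.2 ?_))
      (EReal.coe_le_coe_iff.2 (by linarith))
    linarith [le_max_left a.toReal 0]

theorem ofReal_truncBelow {c : ℝ} (hc : 0 ≤ c) {a : EReal} (ha : a ≠ ⊤) :
    ENNReal.ofReal (truncBelow c a) = erealPos a := by
  induction a with
  | bot => simp [truncBelow, erealPos, hc]
  | top => exact absurd rfl ha
  | coe r =>
    have h : truncBelow c r = max r (-c) := by
      rw [← EReal.coe_eq_coe_iff, coe_truncBelow _ ha,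
        EReal.coe_strictMono.monotone.map_max]
    rw [h, erealPos, if_neg ha, EReal.toReal_coe, ENNReal.ofReal_max,
      ENNReal.ofReal_of_nonpos (neg_nonpos.2 hc)]
    simp

theorem ofReal_neg_truncBelow {c : ℝ} {a : EReal} (ha : a ≠ ⊤) :
    ENNReal.ofReal (-truncBelow c a) = min (erealPos (-a)) (ENNReal.ofReal c) := by
  induction a with
  | bot => simp [truncBelow, erealPos]
  | top => exact absurd rfl ha
  | coe r =>
    have h : -truncBelow c r = min (-r) c := by
      rw [neg_eq_iff_eq_neg, ← max_neg_neg, neg_neg, ← EReal.coe_eq_coe_iff, coe_truncBelow _ ha,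
        EReal.coe_strictMono.monotone.map_max]
    rw [h, ENNReal.ofReal_min, erealPos, ← EReal.coe_neg, if_neg (EReal.coe_ne_top _),
      EReal.toReal_coe]

theorem measurable_erealPos : Measurable erealPos :=
  Measurable.ite (measurableSet_singleton _) measurable_const
    measurable_id.ereal_toReal.ennreal_ofReal

section Integral

variable {X : Type*} [MeasurableSpace X] {μ : Measure X} {g : X → EReal}

theorem eint_ne_top (μ : Measure X) (g : X → EReal) : eint μ g ≠ ⊤ := by
  unfold eint
  split_ifs
  · exact bot_ne_top
  · exact EReal.coe_ne_top _

theorem eint_eq_sub (μ : Measure X) (g : X → EReal) :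
    eint μ g = (((∫⁻ x, erealPos (g x) ∂μ).toReal : ℝ) : EReal) -
      ((∫⁻ x, erealPos (-(g x)) ∂μ : ENNReal) : EReal) := by
  unfold eint
  split_ifs with h
  · rw [h, EReal.coe_ennreal_top, EReal.sub_top]
  · rw [EReal.coe_sub, EReal.coe_ennreal_toReal h]

variable [IsProbabilityMeasure μ]

theorem integrable_truncBelow (hg : Measurable g) (htop : ∀ x, g x ≠ ⊤)
    (hint : Integrable (fun x => max (g x).toReal 0) μ) {c : ℝ} (hc : 0 ≤ c) :
    Integrable (fun x => truncBelow c (g x)) μ :=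
  (hint.add (integrable_const c)).mono' ((measurable_truncBelow c).comp hg).aestronglyMeasurable
    (Eventually.of_forall fun x => abs_truncBelow_le hc (htop x))

theorem coe_integral_truncBelow (hg : Measurable g) (htop : ∀ x, g x ≠ ⊤)
    (hint : Integrable (fun x => max (g x).toReal 0) μ) {c : ℝ} (hc : 0 ≤ c) :
    ((∫ x, truncBelow c (g x) ∂μ : ℝ) : EReal) =
      (((∫⁻ x, erealPos (g x) ∂μ).toReal : ℝ) : EReal) -
        ((∫⁻ x, min (erealPos (-(g x))) (ENNReal.ofReal c) ∂μ : ENNReal) : EReal) := by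
  have hfin : ∫⁻ x, min (erealPos (-(g x))) (ENNReal.ofReal c) ∂μ ≠ ⊤ :=
    ne_top_of_le_ne_top (b := ENNReal.ofReal c) ENNReal.ofReal_ne_top
      ((lintegral_mono fun x => min_le_right _ _).trans (by simp))
  rw [integral_eq_lintegral_pos_part_sub_lintegral_neg_part (integrable_truncBelow hg htop hint hc)]
  simp_rw [fun x => ofReal_truncBelow hc (htop x), fun x => ofReal_neg_truncBelow (c := c) (htop x)]
  rw [EReal.coe_sub, EReal.coe_ennreal_toReal hfin]

theorem tendsto_integral_truncBelow (hg : Measurable g) (htop : ∀ x, g x ≠ ⊤)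
    (hint : Integrable (fun x => max (g x).toReal 0) μ) {n : ℕ} (hn : 1 ≤ n) :
    Tendsto (fun C : ℕ => ((∫ x, truncBelow (C * n) (g x) ∂μ : ℝ) : EReal)) atTop
      (𝓝 (eint μ g)) := by
  have hcoe := fun C : ℕ => coe_integral_truncBelow hg htop hint
    (show (0 : ℝ) ≤ (C : ℝ) * n by positivity)
  simp_rw [hcoe, eint_eq_sub, sub_eq_add_neg]
  have hC : Tendsto (fun C : ℕ => ENNReal.ofReal ((C : ℝ) * n)) atTop (𝓝 ⊤) :=
    ENNReal.tendsto_ofReal_nhds_top.2 (tendsto_natCast_atTop_atTop.atTop_mul_const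
      (by exact_mod_cast hn))
  have hlim : Tendsto (fun C : ℕ => ∫⁻ x, min (erealPos (-(g x))) (ENNReal.ofReal (C * n)) ∂μ)
      atTop (𝓝 (∫⁻ x, erealPos (-(g x)) ∂μ)) := by
    refine lintegral_tendsto_of_tendsto_of_monotone (fun C => ?_) (Eventually.of_forall fun x => ?_)
      (Eventually.of_forall fun x => ?_)
    · exact ((measurable_erealPos.comp hg.neg).min measurable_const).aemeasurable
    · intro C C' h
      exact min_le_min le_rfl (ENNReal.ofReal_le_ofReal (by gcongr))
    · simpa using (tendsto_const_nhds (x := erealPos (-(g x)))).min hC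
  have hlim' := (continuous_neg.tendsto _).comp ((continuous_coe_ennreal_ereal.tendsto _).comp hlim)
  exact (EReal.continuousAt_add (.inl (EReal.coe_ne_top _))
    (.inl (EReal.coe_ne_bot _))).tendsto.comp
    (tendsto_const_nhds.prodMk_nhds hlim')

theorem eint_le_integral_truncBelow (hg : Measurable g) (htop : ∀ x, g x ≠ ⊤)
    (hint : Integrable (fun x => max (g x).toReal 0) μ) {n : ℕ} (hn : 1 ≤ n) (C : ℕ) :
    eint μ g ≤ ((∫ x, truncBelow (C * n) (g x) ∂μ : ℝ) : EReal) := by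
  refine Antitone.le_of_tendsto (fun C C' h => ?_) (tendsto_integral_truncBelow hg htop hint hn) C
  refine EReal.coe_le_coe_iff.2 (integral_mono (integrable_truncBelow hg htop hint (by positivity))
    (integrable_truncBelow hg htop hint (by positivity)) fun x => ?_)
  exact truncBelow_anti (htop x) (by gcongr)

end Integral

theorem coe_lt_inv_mul_iff {n : ℕ} (hn : 1 ≤ n) (b : ℝ) (y : EReal) :
    (b : EReal) < (((n : ℝ)⁻¹ : ℝ) : EReal) * y ↔ ((n * b : ℝ) : EReal) < y := by
  have h : (0 : ℝ) < n := by exact_mod_cast hn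
  induction y with
  | bot => simp [EReal.coe_mul_bot_of_pos (inv_pos.2 h)]
  | top => simp only [EReal.coe_mul_top_of_pos (inv_pos.2 h), EReal.coe_lt_top]
  | coe r => rw [← EReal.coe_mul, EReal.coe_lt_coe_iff, EReal.coe_lt_coe_iff, lt_inv_mul_iff₀ h]

theorem inv_mul_lt_coe_iff {n : ℕ} (hn : 1 ≤ n) (b : ℝ) (y : EReal) :
    (((n : ℝ)⁻¹ : ℝ) : EReal) * y < b ↔ y < ((n * b : ℝ) : EReal) := by
  have h : (0 : ℝ) < n := by exact_mod_cast hn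
  induction y with
  | bot => simp only [EReal.coe_mul_bot_of_pos (inv_pos.2 h), EReal.bot_lt_coe]
  | top => simp [EReal.coe_mul_top_of_pos (inv_pos.2 h)]
  | coe r => rw [← EReal.coe_mul, EReal.coe_lt_coe_iff, EReal.coe_lt_coe_iff, inv_mul_lt_iff₀ h]

/-- The truncation at `-C n` of a subadditive sequence of extended real functions. -/
def truncProcess {X : Type*} (f : ℕ → X → EReal) (C n : ℕ) (x : X) : ℝ :=
  if n = 0 then 0 else truncBelow (C * n) (f n x)

theorem truncProcess_of_one_le {X : Type*} (f : ℕ → X → EReal) (C : ℕ) {n : ℕ} (hn : 1 ≤ n) :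
    truncProcess f C n = fun x => truncBelow (C * n) (f n x) := by
  funext x
  exact if_neg (by omega)

theorem subadditiveProcess_truncProcess {X : Type*} {T : X → X} {f : ℕ → X → EReal}
    (htop : ∀ n x, f n x ≠ ⊤)
    (hsub : ∀ n m, 1 ≤ n → 1 ≤ m → ∀ x, f (n + m) x ≤ f n x + f m (T^[n] x)) (C : ℕ) :
    SubadditiveProcess T (truncProcess f C) where
  zero x := by simp [truncProcess]
  add_le n m x := by
    rcases Nat.eq_zero_or_pos n with rfl | hn
    · simp [truncProcess]
    rcases Nat.eq_zero_or_pos m with rfl | hm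
    · simp [truncProcess]
    rw [truncProcess_of_one_le f C hn, truncProcess_of_one_le f C hm,
      truncProcess_of_one_le f C (show 1 ≤ n + m by omega), Nat.cast_add, mul_add]
    exact truncBelow_add_le _ _ (htop _ _) (htop _ _) (htop _ _) (hsub n m hn hm x)

theorem le_coe_birkhoffSum {X : Type*} {T : X → X} {f : ℕ → X → EReal} (htop : ∀ x, f 1 x ≠ ⊤)
    (hsub : ∀ n m, 1 ≤ n → 1 ≤ m → ∀ x, f (n + m) x ≤ f n x + f m (T^[n] x)) {n : ℕ} (hn : 1 ≤ n)
    (x : X) : f n x ≤ (birkhoffSum T (fun y => max (f 1 y).toReal 0) n x : ℝ) := by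
  have h1 : ∀ y, f 1 y ≤ (max (f 1 y).toReal 0 : ℝ) := fun y =>
    (EReal.le_coe_toReal (htop y)).trans (EReal.coe_le_coe_iff.2 (le_max_left _ _))
  induction n, hn using Nat.le_induction with
  | base => simpa using h1 x
  | succ n hn ih =>
    rw [birkhoffSum_succ, EReal.coe_add]
    exact (hsub n 1 hn le_rfl x).trans (add_le_add ih (h1 _))

theorem integrable_posPart {X : Type*} [MeasurableSpace X] {μ : Measure X} {T : X → X}
    (hT : MeasurePreserving T μ μ) {f : ℕ → X → EReal} (hmeas : ∀ n, Measurable (f n))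
    (htop : ∀ x, f 1 x ≠ ⊤) (hL1 : Integrable (fun x => max (f 1 x).toReal 0) μ)
    (hsub : ∀ n m, 1 ≤ n → 1 ≤ m → ∀ x, f (n + m) x ≤ f n x + f m (T^[n] x)) {n : ℕ}
    (hn : 1 ≤ n) : Integrable (fun x => max (f n x).toReal 0) μ := by
  refine (integral_birkhoffSum hT hL1 n).1.mono'
    ((hmeas n).ereal_toReal.max measurable_const).aestronglyMeasurable
    (Eventually.of_forall fun x => ?_)
  have h0 := birkhoffSum_nonneg (T := T) (fun y => le_max_right (f 1 y).toReal 0) n x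
  rw [Real.norm_eq_abs, abs_of_nonneg (le_max_right _ _)]
  refine max_le ?_ h0
  have hle := le_coe_birkhoffSum htop hsub hn x
  generalize f n x = a at hle
  induction a with
  | bot => simpa using h0
  | top => simpa using h0
  | coe r => simpa using hle

/-- **Kingman's subadditive ergodic theorem.** Let `(X, μ, T)` be ergodic and
`f_n : X → [-∞, +∞)` measurable with `f₁⁺ ∈ L¹(μ)` and
`f_{n+m} ≤ f_n + f_m ∘ Tⁿ`. Then the sequence of integrals `∫ f_n dμ` is
sub-additive, and for `μ`-a.e. `x`, `(1/n) f_n(x)` converges to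
`inf_{n ≥ 1} (1/n) ∫ f_n dμ ∈ [-∞, +∞)`. -/
theorem kingman_subadditive_ergodic
    {X : Type*} [MeasurableSpace X] (μ : Measure X) [IsProbabilityMeasure μ]
    (T : X → X) (hT : Ergodic T μ)
    (f : ℕ → X → EReal) (hmeas : ∀ n, Measurable (f n))
    (htop : ∀ n x, f n x ≠ ⊤)
    (hL1 : Integrable (fun x => max (f 1 x).toReal 0) μ)
    (hsub : ∀ n m, 1 ≤ n → 1 ≤ m → ∀ x, f (n + m) x ≤ f n x + f m (T^[n] x)) :
    (∀ n m, 1 ≤ n → 1 ≤ m → eint μ (f (n + m)) ≤ eint μ (f n) + eint μ (f m)) ∧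
    (∀ᵐ x ∂μ, Filter.Tendsto (fun n : ℕ => (((n : ℝ)⁻¹ : ℝ) : EReal) * f n x)
      Filter.atTop
      (𝓝 (⨅ n : {n : ℕ // 1 ≤ n}, (((n.1 : ℝ)⁻¹ : ℝ) : EReal) * eint μ (f n.1)))) := by
  have hTm := hT.toMeasurePreserving
  have hpos : ∀ {n}, 1 ≤ n → Integrable (fun x => max (f n x).toReal 0) μ := fun hn =>
    integrable_posPart hTm hmeas (htop 1) hL1 hsub hn
  have hproc := subadditiveProcess_truncProcess htop hsub
  have hgmeas : ∀ C n, Measurable (truncProcess f C n) := by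
    intro C n
    rcases Nat.eq_zero_or_pos n with rfl | hn
    · exact measurable_const
    · rw [truncProcess_of_one_le f C hn]
      exact (measurable_truncBelow _).comp (hmeas n)
  have hgint : ∀ C n, Integrable (truncProcess f C n) μ := by
    intro C n
    rcases Nat.eq_zero_or_pos n with rfl | hn
    · exact integrable_zero _ _ _
    · rw [truncProcess_of_one_le f C hn]
      exact integrable_truncBelow (hmeas n) (htop n) (hpos hn) (by positivity)
  have hlim : ∀ {n}, 1 ≤ n → Tendsto (fun C : ℕ => ((∫ x, truncProcess f C n x ∂μ : ℝ) : EReal))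
      atTop (𝓝 (eint μ (f n))) := by
    intro n hn
    simp_rw [fun C => truncProcess_of_one_le f C hn]
    exact tendsto_integral_truncBelow (hmeas n) (htop n) (hpos hn) hn
  have hle : ∀ {n}, 1 ≤ n → ∀ C : ℕ, eint μ (f n) ≤ (∫ x, truncProcess f C n x ∂μ : ℝ) := by
    intro n hn C
    rw [truncProcess_of_one_le f C hn]
    exact eint_le_integral_truncBelow (hmeas n) (htop n) (hpos hn) hn C
  constructor
  · intro n m hn hm
    refine le_of_tendsto_of_tendsto' (hlim (show 1 ≤ n + m by omega))
      ((EReal.continuousAt_add (.inl (eint_ne_top μ (f n)))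
        (.inr (eint_ne_top μ (f m)))).tendsto.comp
        ((hlim hn).prodMk_nhds (hlim hm))) fun C => ?_
    have hshift : Integrable (fun x => truncProcess f C m (T^[n] x)) μ :=
      (hTm.iterate n).integrable_comp_of_integrable (hgint C m)
    have hcomp : ∫ x, truncProcess f C m (T^[n] x) ∂μ = ∫ x, truncProcess f C m x ∂μ := by
      have h := (hTm.iterate n).map_eq
      rw [← integral_map (hTm.iterate n).measurable.aemeasurable
        (hgmeas C m).aestronglyMeasurable, h]
    refine EReal.coe_le_coe_iff.2 ?_
    calc ∫ x, truncProcess f C (n + m) x ∂μ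
        ≤ ∫ x, (truncProcess f C n x + truncProcess f C m (T^[n] x)) ∂μ :=
          integral_mono (hgint C _) ((hgint C n).add hshift) ((hproc C).add_le n m)
      _ = _ := by rw [integral_add (hgint C n) hshift, hcomp]
  set L := ⨅ n : {n : ℕ // 1 ≤ n}, (((n.1 : ℝ)⁻¹ : ℝ) : EReal) * eint μ (f n.1)
  have hlower : ∀ᵐ x ∂μ, ∀ b : ℚ, ((b : ℝ) : EReal) < L →
      ∀ᶠ n : ℕ in atTop, ((b : ℝ) : EReal) ≤ (((n : ℝ)⁻¹ : ℝ) : EReal) * f n x := by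
    refine ae_all_iff.2 fun b => ?_
    by_cases hb : ((b : ℝ) : EReal) < L
    swap
    · exact Eventually.of_forall fun x h => absurd h hb
    obtain ⟨c, hbc, hcL⟩ := EReal.lt_iff_exists_real_btwn.1 hb
    rw [EReal.coe_lt_coe_iff] at hbc
    obtain ⟨C, hC⟩ := exists_nat_gt (-(b : ℝ))
    have hcI : ∀ n : ℕ, n * c ≤ ∫ x, truncProcess f C n x ∂μ := by
      intro n
      rcases Nat.eq_zero_or_pos n with rfl | hn
      · simp [truncProcess]
      have h1 : (c : EReal) < (((n : ℝ)⁻¹ : ℝ) : EReal) * eint μ (f n) :=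
        hcL.trans_le (iInf_le _ (⟨n, hn⟩ : {n : ℕ // 1 ≤ n}))
      rw [coe_lt_inv_mul_iff hn] at h1
      exact EReal.coe_le_coe_iff.1 (h1.le.trans (hle hn C))
    obtain ⟨b', hbb', hb'c⟩ := exists_between hbc
    filter_upwards [(hproc C).ae_eventually_mul_le hT (hgmeas C) (hgint C) hcI hb'c] with x hx _
    filter_upwards [hx, eventually_ge_atTop 1] with n hn hn1
    have hn0 : (0 : ℝ) < n := by exact_mod_cast hn1
    refine ((coe_lt_inv_mul_iff hn1 b (f n x)).2 ?_).le
    have hlt : (((n : ℝ) * b : ℝ) : EReal) < (truncProcess f C n x : ℝ) :=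
      EReal.coe_lt_coe_iff.2 ((mul_lt_mul_of_pos_left hbb' hn0).trans_le hn)
    rw [truncProcess_of_one_le f C hn1, coe_truncBelow _ (htop n x), lt_max_iff] at hlt
    refine hlt.resolve_right fun h => ?_
    rw [EReal.coe_lt_coe_iff] at h
    nlinarith
  have hupper : ∀ᵐ x ∂μ, ∀ b : ℚ, L < ((b : ℝ) : EReal) →
      ∀ᶠ n : ℕ in atTop, (((n : ℝ)⁻¹ : ℝ) : EReal) * f n x ≤ ((b : ℝ) : EReal) := by
    refine ae_all_iff.2 fun b => ?_
    by_cases hb : L < ((b : ℝ) : EReal)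
    swap
    · exact Eventually.of_forall fun x h => absurd h hb
    obtain ⟨⟨m, hm⟩, hmb⟩ := iInf_lt_iff.1 hb
    rw [inv_mul_lt_coe_iff hm] at hmb
    obtain ⟨C, hC⟩ := ((hlim hm).eventually_lt_const hmb).exists
    rw [EReal.coe_lt_coe_iff] at hC
    filter_upwards [(hproc C).ae_eventually_le_mul hT (hgmeas C) (hgint C) hm hC] with x hx _
    filter_upwards [hx, eventually_ge_atTop 1] with n hn hn1
    refine not_lt.1 fun hlt => ?_
    rw [coe_lt_inv_mul_iff hn1] at hlt
    have hle' : f n x ≤ (truncProcess f C n x : ℝ) := by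
      rw [truncProcess_of_one_le f C hn1, coe_truncBelow _ (htop n x)]
      exact le_max_left _ _
    exact absurd hn (not_le.2 (EReal.coe_lt_coe_iff.1 (hlt.trans_le hle')))
  filter_upwards [hlower, hupper] with x hxl hxu
  refine tendsto_order.2 ⟨fun a ha => ?_, fun a ha => ?_⟩
  · obtain ⟨b, hab, hbL⟩ := EReal.lt_iff_exists_rat_btwn.1 ha
    filter_upwards [hxl b hbL] with n hn using hab.trans_le hn
  · obtain ⟨b, hLb, hba⟩ := EReal.lt_iff_exists_rat_btwn.1 ha
    filter_upwards [hxu b hLb] with n hn using hn.trans_lt hba
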